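/- arXiv:2509.12434 — 2 statements merged into one kernel-verified Lean document; each statement's English description precedes it below -/
import Mathlib

section
/- In the finite-horizon entropy-regularized setup, fix an initial state s_1 ∈ S_1. For any policy ρ = (ρ_1, …, ρ_H), where ρ_h(·|s) is a probability distribution on A for each s ∈ S_h, define the trajectory objective J(ρ; s_1) as the expectation of u(s_H, a_H) + Σ_{h=1}^{H} [ α H(ρ_h(·|s_h)) − β H(ρ_h(·|s_h), π_ref,h(·|s_h)) ] over random trajectories generated by a_h ∼ ρ_h(·|s_h), o_h ∼ P_h(·|s_h, a_h), s_{h+1} = T_h(s_h, a_h, o_h). Then J(ρ; s_1) ≤ α log Z_1(s_1) for every policy ρ, and equality holds for the backward-induction policy ρ = (π_1, …, π_H). -/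
/-- Shannon entropy of a distribution on a finite type (with `0 * log 0 = 0`). -/
noncomputable def Hent {Ω : Type*} [Fintype Ω] (p : Ω → ℝ) : ℝ :=
  -∑ w, p w * Real.log (p w)

/-- Cross-entropy `H(p, q)`. -/
noncomputable def Hcross {Ω : Type*} [Fintype Ω] (p q : Ω → ℝ) : ℝ :=
  -∑ w, p w * Real.log (q w)

/-- Gibbs variational inequality: `log ∑ w` bounds the expectation of `log w` plus the entropy. -/
theorem sum_mul_log_add_Hent_le {Ω : Type*} [Fintype Ω] [Nonempty Ω] {p w : Ω → ℝ}
    (hp : ∀ a, 0 ≤ p a) (hsum : ∑ a, p a = 1) (hw : ∀ a, 0 < w a) :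
    ∑ a, p a * Real.log (w a) + Hent p ≤ Real.log (∑ a, w a) := by
  have hW : 0 < ∑ a, w a := Finset.sum_pos (fun a _ => hw a) Finset.univ_nonempty
  set W := ∑ a, w a with hWdef
  have key : ∀ a, p a * Real.log (w a) - p a * Real.log (p a) - p a * Real.log W
      ≤ w a / W - p a := by
    intro a
    rcases (hp a).eq_or_lt with h0 | h0
    · rw [← h0]
      simpa using (div_pos (hw a) hW).le
    · have hlog := Real.log_le_sub_one_of_pos (div_pos (div_pos (hw a) hW) h0)
      rw [Real.log_div (div_pos (hw a) hW).ne' h0.ne', Real.log_div (hw a).ne' hW.ne'] at hlog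
      have hmul := mul_le_mul_of_nonneg_left hlog h0.le
      have hcancel : p a * (w a / W / p a) = w a / W := mul_div_cancel₀ _ h0.ne'
      linarith
  have hle := Finset.sum_le_sum fun a (_ : a ∈ Finset.univ) => key a
  simp only [Finset.sum_sub_distrib, ← Finset.sum_mul, ← Finset.sum_div, hsum] at hle
  rw [← hWdef, div_self hW.ne'] at hle
  unfold Hent
  linarith

/-- The Gibbs distribution attains equality in the variational inequality. -/
theorem sum_mul_log_add_Hent_eq {Ω : Type*} [Fintype Ω] [Nonempty Ω] {p w : Ω → ℝ}
    (hw : ∀ a, 0 < w a) (hpw : ∀ a, p a = w a / ∑ b, w b) :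
    ∑ a, p a * Real.log (w a) + Hent p = Real.log (∑ a, w a) := by
  have hW : 0 < ∑ a, w a := Finset.sum_pos (fun a _ => hw a) Finset.univ_nonempty
  have hsum : ∑ a, p a = 1 := by
    simp only [hpw, ← Finset.sum_div]
    exact div_self hW.ne'
  have hlog : ∀ a, Real.log (p a) = Real.log (w a) - Real.log (∑ b, w b) := fun a => by
    rw [hpw, Real.log_div (hw a).ne' hW.ne']
  simp only [Hent, hlog, mul_sub, Finset.sum_sub_distrib, ← Finset.sum_mul, hsum]
  ring

section SoftmaxWeights

variable {Ω : Type*} [Fintype Ω] {α β : ℝ} {p r q : Ω → ℝ}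

theorem regularized_objective_eq (hα : 0 < α) (hr : ∀ a, 0 < r a) :
    ∑ a, p a * q a + α * Hent p - β * Hcross p r =
      α * (∑ a, p a * Real.log (r a ^ (β / α) * Real.exp (q a / α)) + Hent p) := by
  have hlog : ∀ a, Real.log (r a ^ (β / α) * Real.exp (q a / α)) =
      β / α * Real.log (r a) + q a / α := fun a => by
    rw [Real.log_mul (Real.rpow_pos_of_pos (hr a) _).ne' (Real.exp_pos _).ne',
      Real.log_rpow (hr a), Real.log_exp]
  have hterm : ∀ a, α * (p a * (β / α * Real.log (r a) + q a / α)) =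
      β * (p a * Real.log (r a)) + p a * q a := fun a => by
    field_simp
  simp only [hlog, mul_add α, Finset.mul_sum, hterm, Finset.sum_add_distrib]
  rw [← Finset.mul_sum, Hcross]
  ring

variable [Nonempty Ω]

theorem regularized_objective_le (hα : 0 < α) (hr : ∀ a, 0 < r a)
    (hp : ∀ a, 0 ≤ p a) (hsum : ∑ a, p a = 1) :
    ∑ a, p a * q a + α * Hent p - β * Hcross p r ≤
      α * Real.log (∑ a, r a ^ (β / α) * Real.exp (q a / α)) := by
  rw [regularized_objective_eq hα hr]
  exact mul_le_mul_of_nonneg_left (sum_mul_log_add_Hent_le hp hsum fun a =>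
    mul_pos (Real.rpow_pos_of_pos (hr a) _) (Real.exp_pos _)) hα.le

theorem regularized_objective_eq_of_softmax (hα : 0 < α) (hr : ∀ a, 0 < r a)
    (hp : ∀ a, p a = r a ^ (β / α) * Real.exp (q a / α) /
      ∑ b, r b ^ (β / α) * Real.exp (q b / α)) :
    ∑ a, p a * q a + α * Hent p - β * Hcross p r =
      α * Real.log (∑ a, r a ^ (β / α) * Real.exp (q a / α)) := by
  rw [regularized_objective_eq hα hr, sum_mul_log_add_Hent_eq (fun a =>
    mul_pos (Real.rpow_pos_of_pos (hr a) _) (Real.exp_pos _)) hp]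

end SoftmaxWeights

/-
Finite-horizon entropy-regularized setup with horizon `H = N + 1 ≥ 1`:
states `S h` for `h : Fin (N+1)`, actions `A`, observations `O`,
transitions `T`, observation kernels `P`, reference policies `piRef`,
terminal utility `u`, and the backward-induction quantities
`Q`, `Z`, `pol` (the optimal policy) and `V`, characterized by their
defining equations given as hypotheses.
-/
theorem stmt_14 {N : ℕ}
    {S : Fin (N + 1) → Type*} [∀ h, Fintype (S h)] [∀ h, Nonempty (S h)]
    {A : Type*} [Fintype A] [Nonempty A]
    {O : Type*} [Fintype O] [Nonempty O]
    (T : ∀ h : Fin N, S h.castSucc → A → O → S h.succ)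
    (P : ∀ h : Fin N, S h.castSucc → A → O → ℝ)
    (hPpos : ∀ h s a o, 0 ≤ P h s a o)
    (hPsum : ∀ h s a, ∑ o, P h s a o = 1)
    (piRef : ∀ h : Fin (N + 1), S h → A → ℝ)
    (hrefpos : ∀ h s a, 0 < piRef h s a)
    (hrefsum : ∀ h s, ∑ a, piRef h s a = 1)
    (u : S (Fin.last N) → A → ℝ)
    (α β : ℝ) (hα : 0 < α) (hβ : 0 ≤ β)
    (Q : ∀ h : Fin (N + 1), S h → A → ℝ)
    (Z : ∀ h : Fin (N + 1), S h → ℝ)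
    (pol : ∀ h : Fin (N + 1), S h → A → ℝ)
    (V : ∀ h : Fin (N + 1), S h → ℝ)
    (hQlast : ∀ s a, Q (Fin.last N) s a = u s a)
    (hQ : ∀ (h : Fin N) (s : S h.castSucc) (a : A),
      Q h.castSucc s a = ∑ o, P h s a o * V h.succ (T h s a o))
    (hZ : ∀ (h : Fin (N + 1)) (s : S h),
      Z h s = ∑ a, piRef h s a ^ (β / α) * Real.exp (Q h s a / α))
    (hpol : ∀ (h : Fin (N + 1)) (s : S h) (a : A),
      pol h s a = piRef h s a ^ (β / α) * Real.exp (Q h s a / α) / Z h s)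
    (hV : ∀ (h : Fin (N + 1)) (s : S h), V h s = α * Real.log (Z h s))
    -- an arbitrary policy `ρ` ...
    (ρ : ∀ h : Fin (N + 1), S h → A → ℝ)
    (hρpos : ∀ h s a, 0 ≤ ρ h s a) (hρsum : ∀ h s, ∑ a, ρ h s a = 1)
    -- ... and the expectation `JV h s` of
    -- `u(s_H, a_H) + ∑_{k ≥ h} (α H(ρ_k(·|s_k)) − β H(ρ_k(·|s_k), πref_k(·|s_k)))`
    -- over trajectories generated by `ρ` from state `s` at step `h`,
    -- characterized by the tower rule / backward recursion:
    (JV : ∀ h : Fin (N + 1), S h → ℝ)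
    (hJlast : ∀ s : S (Fin.last N),
      JV (Fin.last N) s = ∑ a, ρ (Fin.last N) s a * u s a
        + α * Hent (ρ (Fin.last N) s)
        - β * Hcross (ρ (Fin.last N) s) (piRef (Fin.last N) s))
    (hJstep : ∀ (h : Fin N) (s : S h.castSucc),
      JV h.castSucc s =
        ∑ a, ρ h.castSucc s a * ∑ o, P h s a o * JV h.succ (T h s a o)
        + α * Hent (ρ h.castSucc s)
        - β * Hcross (ρ h.castSucc s) (piRef h.castSucc s))
    -- a fixed initial state
    (s1 : S 0) :
    JV 0 s1 ≤ α * Real.log (Z 0 s1) ∧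
      ((∀ h s a, ρ h s a = pol h s a) → JV 0 s1 = α * Real.log (Z 0 s1)) := by
  have hle : ∀ h s, ∑ a, ρ h s a * Q h s a + α * Hent (ρ h s) - β * Hcross (ρ h s) (piRef h s)
      ≤ V h s := fun h s => by
    rw [hV, hZ]
    exact regularized_objective_le hα (hrefpos h s) (hρpos h s) (hρsum h s)
  rw [← hV]
  constructor
  · suffices hall : ∀ h s, JV h s ≤ V h s from hall 0 s1
    intro h
    induction h using Fin.reverseInduction with
    | last =>
      intro s
      rw [hJlast]
      simpa only [hQlast] using hle (Fin.last N) s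
    | cast h ih =>
      intro s
      rw [hJstep]
      refine le_trans ?_ (hle h.castSucc s)
      simp only [hQ]
      gcongr with a _ o _
      · exact hρpos _ _ _
      · exact hPpos _ _ _ _
      · exact ih _
  · intro hρ
    have heq : ∀ h s, ∑ a, ρ h s a * Q h s a + α * Hent (ρ h s)
        - β * Hcross (ρ h s) (piRef h s) = V h s := fun h s => by
      rw [hV, hZ]
      exact regularized_objective_eq_of_softmax hα (hrefpos h s) fun a => by rw [hρ, hpol, hZ]
    suffices hall : ∀ h s, JV h s = V h s from hall 0 s1
    intro h
    induction h using Fin.reverseInduction with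
    | last =>
      intro s
      rw [hJlast]
      simpa only [hQlast] using heq (Fin.last N) s
    | cast h ih =>
      intro s
      rw [hJstep, ← heq]
      simp only [hQ, ih]
end

section
/- In the finite-horizon entropy-regularized setup with deterministic observations (maps g_h : S_h × A → O with P_h(·|s,a) the point mass at g_h(s,a)), fix an initial state s_1 ∈ S_1 and, for any trajectory τ = (s_1, a_1, s_2, …, s_H, a_H) with s_{h+1} = T_h(s_h, a_h, g_h(s_h, a_h)), define the implicit reward r(τ) = Σ_{h=1}^{H} log( π_h(a_h|s_h) / π_ref,h(a_h|s_h)^{β/α} ). Then for any two such trajectories τ⁺ and τ⁻ starting from the same s_1: σ( u(s_H⁺, a_H⁺) − u(s_H⁻, a_H⁻) ) = σ( α · ( r(τ⁺) − r(τ⁻) ) ), where σ(t) = 1/(1 + exp(−t)) is the logistic sigmoid. -/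
/-- The logistic sigmoid `σ(t) = 1 / (1 + exp (−t))`. -/
noncomputable def sigmoid (t : ℝ) : ℝ := 1 / (1 + Real.exp (-t))

/-- A scaled log-ratio of a softmax policy against its base weight is the advantage `q - v`. -/
lemma mul_log_softmax_div {α w q z : ℝ} (hα : α ≠ 0) (hw : w ≠ 0) (hz : z ≠ 0) :
    α * Real.log (w * Real.exp (q / α) / z / w) = q - α * Real.log z := by
  have h : w * Real.exp (q / α) / z / w = Real.exp (q / α) / z := by
    field_simp
  rw [h, Real.log_div (Real.exp_ne_zero _) hz, Real.log_exp, mul_sub, mul_div_cancel₀ _ hα]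

/-- If each `q` is the next `v`, then the sum of the differences `q - v` telescopes. -/
lemma Fin.sum_sub_of_castSucc_eq_succ {N : ℕ} {M : Type*} [AddCommGroup M] (q v : Fin (N + 1) → M)
    (h : ∀ i : Fin N, q i.castSucc = v i.succ) :
    ∑ i, (q i - v i) = q (Fin.last N) - v 0 := by
  rw [Finset.sum_sub_distrib, Fin.sum_univ_castSucc q, Fin.sum_univ_succ v]
  simp only [h]
  abel

/-
Finite-horizon entropy-regularized setup with horizon `H = N + 1 ≥ 1`:
states `S h` for `h : Fin (N+1)`, actions `A`, observations `O`,
transitions `T`, observation kernels `P`, reference policies `piRef`,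
terminal utility `u`, and the backward-induction quantities
`Q`, `Z`, `pol` (the optimal policy) and `V`, characterized by their
defining equations given as hypotheses.
-/
theorem stmt_15 {N : ℕ}
    {S : Fin (N + 1) → Type*} [∀ h, Fintype (S h)] [∀ h, Nonempty (S h)]
    {A : Type*} [Fintype A] [Nonempty A]
    {O : Type*} [Fintype O] [Nonempty O]
    (T : ∀ h : Fin N, S h.castSucc → A → O → S h.succ)
    (P : ∀ h : Fin N, S h.castSucc → A → O → ℝ)
    (hPpos : ∀ h s a o, 0 ≤ P h s a o)
    (hPsum : ∀ h s a, ∑ o, P h s a o = 1)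
    (piRef : ∀ h : Fin (N + 1), S h → A → ℝ)
    (hrefpos : ∀ h s a, 0 < piRef h s a)
    (hrefsum : ∀ h s, ∑ a, piRef h s a = 1)
    (u : S (Fin.last N) → A → ℝ)
    (α β : ℝ) (hα : 0 < α) (hβ : 0 ≤ β)
    (Q : ∀ h : Fin (N + 1), S h → A → ℝ)
    (Z : ∀ h : Fin (N + 1), S h → ℝ)
    (pol : ∀ h : Fin (N + 1), S h → A → ℝ)
    (V : ∀ h : Fin (N + 1), S h → ℝ)
    (hQlast : ∀ s a, Q (Fin.last N) s a = u s a)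
    (hQ : ∀ (h : Fin N) (s : S h.castSucc) (a : A),
      Q h.castSucc s a = ∑ o, P h s a o * V h.succ (T h s a o))
    (hZ : ∀ (h : Fin (N + 1)) (s : S h),
      Z h s = ∑ a, piRef h s a ^ (β / α) * Real.exp (Q h s a / α))
    (hpol : ∀ (h : Fin (N + 1)) (s : S h) (a : A),
      pol h s a = piRef h s a ^ (β / α) * Real.exp (Q h s a / α) / Z h s)
    (hV : ∀ (h : Fin (N + 1)) (s : S h), V h s = α * Real.log (Z h s))
    [DecidableEq O]
    -- deterministic observations
    (g : ∀ h : Fin N, S h.castSucc → A → O)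
    (hdet : ∀ (h : Fin N) (s : S h.castSucc) (a : A) (o' : O),
      P h s a o' = if o' = g h s a then 1 else 0)
    -- two trajectories starting from the same initial state `s1`
    (s1 : S 0)
    (sp : ∀ h : Fin (N + 1), S h) (ap : Fin (N + 1) → A)
    (sm : ∀ h : Fin (N + 1), S h) (am : Fin (N + 1) → A)
    (hsp0 : sp 0 = s1) (hsm0 : sm 0 = s1)
    (htrajp : ∀ h : Fin N, sp h.succ =
      T h (sp h.castSucc) (ap h.castSucc) (g h (sp h.castSucc) (ap h.castSucc)))
    (htrajm : ∀ h : Fin N, sm h.succ =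
      T h (sm h.castSucc) (am h.castSucc) (g h (sm h.castSucc) (am h.castSucc)))
    -- implicit rewards of the two trajectories
    (rp rm : ℝ)
    (hrp : rp = ∑ h : Fin (N + 1),
      Real.log (pol h (sp h) (ap h) / piRef h (sp h) (ap h) ^ (β / α)))
    (hrm : rm = ∑ h : Fin (N + 1),
      Real.log (pol h (sm h) (am h) / piRef h (sm h) (am h) ^ (β / α))) :
    sigmoid (u (sp (Fin.last N)) (ap (Fin.last N))
        - u (sm (Fin.last N)) (am (Fin.last N))) =
      sigmoid (α * (rp - rm)) := by
  have hw (h s a) : 0 < piRef h s a ^ (β / α) := Real.rpow_pos_of_pos (hrefpos h s a) _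
  have hZpos (h s) : 0 < Z h s := by
    rw [hZ]
    exact Finset.sum_pos (fun a _ => mul_pos (hw h s a) (Real.exp_pos _)) Finset.univ_nonempty
  have key (s : ∀ h : Fin (N + 1), S h) (a : Fin (N + 1) → A)
      (htraj : ∀ h : Fin N, s h.succ =
        T h (s h.castSucc) (a h.castSucc) (g h (s h.castSucc) (a h.castSucc))) :
      α * ∑ h : Fin (N + 1), Real.log (pol h (s h) (a h) / piRef h (s h) (a h) ^ (β / α)) =
        u (s (Fin.last N)) (a (Fin.last N)) - V 0 (s 0) := by
    have hadv (h : Fin (N + 1)) :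
        α * Real.log (pol h (s h) (a h) / piRef h (s h) (a h) ^ (β / α)) =
          Q h (s h) (a h) - V h (s h) := by
      rw [hpol, hV]
      exact mul_log_softmax_div hα.ne' (hw _ _ _).ne' (hZpos _ _).ne'
    simp only [Finset.mul_sum, hadv]
    rw [Fin.sum_sub_of_castSucc_eq_succ (fun h => Q h (s h) (a h)) (fun h => V h (s h)), hQlast]
    intro h
    simp only [hQ, hdet, htraj, ite_mul, one_mul, zero_mul, Finset.sum_ite_eq',
      Finset.mem_univ, if_true]
  rw [hrp, hrm, mul_sub, key sp ap htrajp, key sm am htrajm, hsp0, hsm0, sub_sub_sub_cancel_right]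
end
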